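/- arXiv:2405.10995 — 4 statements merged into one kernel-verified Lean document; each statement's English description precedes it below -/
import Mathlib

section
/- Fix integers M ≥ 3 and m ≥ 1. Suppose a single-layer linear vanilla RNN with m neurons, with parameters w_h, u_h, w_y ∈ ℝ^m whose recurrent weights u_h^{(1)}, …, u_h^{(m)} are pairwise distinct, computes the first-order derivative of every length-M time series, i.e. for every x ∈ ℝ^M and every t with 2 ≤ t ≤ M the output satisfies y_t = x_t − x_{t−1}. Then m > M − 2, i.e. m ≥ M − 1. -/
/-- A single-layer linear vanilla RNN with `m` neurons and parameters
`wh, uh, wy : Fin m → ℝ` computes, on input `x`, the output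
`y t = ∑ l, wy l * wh l * ∑ s ∈ Icc 1 t, (uh l) ^ (t - s) * x s`.
If the recurrent weights `uh` are pairwise distinct and the RNN computes the
first-order derivative of every length-`M` time series (i.e. `y t = x t - x (t-1)`
for all `2 ≤ t ≤ M`), then `m ≥ M - 1`. -/
theorem rnn_neuron_lower_bound (M m : ℕ) (hM : 3 ≤ M) (hm : 1 ≤ m)
    (wh uh wy : Fin m → ℝ) (hdist : Function.Injective uh)
    (hcomp : ∀ x : ℕ → ℝ, ∀ t : ℕ, 2 ≤ t → t ≤ M →
      (∑ l : Fin m, wy l * wh l * ∑ s ∈ Finset.Icc 1 t, uh l ^ (t - s) * x s)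
        = x t - x (t - 1)) :
    M - 1 ≤ m := by
  by_contra hlt
  have key : ∀ k, k < M → (∑ l : Fin m, wy l * wh l * uh l ^ k)
      = (if k = 0 then 1 else 0) - (if k = 1 then 1 else 0) := by
    intro k hk
    have h := hcomp (fun s => if s = M - k then 1 else 0) M (by omega) le_rfl
    have e : ∀ l : Fin m, (∑ s ∈ Finset.Icc 1 M, uh l ^ (M - s) *
        (if s = M - k then (1 : ℝ) else 0)) = uh l ^ k := by
      intro l
      rw [Finset.sum_eq_single (M - k)]
      · rw [if_pos rfl, mul_one]
        congr 1
        omega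
      · intro b _ hb
        rw [if_neg hb, mul_zero]
      · intro hb
        exact absurd (Finset.mem_Icc.2 ⟨by omega, by omega⟩) hb
    simp only [e] at h
    rw [h]
    have h0 : (M = M - k) ↔ k = 0 := by omega
    have h1 : (M - 1 = M - k) ↔ k = 1 := by omega
    simp only [h0, h1]
  have hz : (fun l => wy l * wh l * uh l ^ 2) = 0 := by
    apply Matrix.eq_zero_of_forall_pow_sum_mul_pow_eq_zero hdist
    intro j
    have h := key (j + 2) (by have := j.2; omega)
    rw [if_neg (by omega), if_neg (by omega), sub_zero] at h
    rw [← h]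
    apply Finset.sum_congr rfl
    intro l _
    ring
  have h1 := key 1 (by omega)
  rw [Finset.sum_eq_zero] at h1
  · norm_num at h1
  · intro l _
    have h := congrFun hz l
    simp only [Pi.zero_apply] at h
    rcases mul_eq_zero.1 h with h | h
    · rw [h, zero_mul]
    · rw [pow_eq_zero_iff (by norm_num)] at h
      rw [h]
      ring
end

section
/- Fix an integer M ≥ 3. There exist no real numbers w_y, w_h, u_h such that a single-layer linear vanilla RNN with one neuron and these parameters computes the first-order derivative of every length-M time series; i.e., there are no reals w_y, w_h, u_h with w_y w_h Σ_{s=1}^{t} u_h^{t−s} x_s = x_t − x_{t−1} for every x ∈ ℝ^M and every t with 2 ≤ t ≤ M. -/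
/-- For `M ≥ 3`, there are no parameters `wy, wh, uh : ℝ` such that the one-neuron
single-layer linear vanilla RNN output
`y t = wy * wh * ∑ s ∈ Icc 1 t, uh ^ (t - s) * x s`
equals the first-order derivative `x t - x (t - 1)` for every length-`M` time series
`x` and every `t` with `2 ≤ t ≤ M`. -/
theorem one_neuron_rnn_cannot_differentiate (M : ℕ) (hM : 3 ≤ M) :
    ¬ ∃ wy wh uh : ℝ, ∀ x : ℕ → ℝ, ∀ t : ℕ, 2 ≤ t → t ≤ M →
      wy * wh * ∑ s ∈ Finset.Icc 1 t, uh ^ (t - s) * x s = x t - x (t - 1) := by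
  rintro ⟨wy, wh, uh, h⟩
  have h1 := h (fun n => if n = 1 then 1 else 0) 3 (by norm_num) hM
  have h2 := h (fun n => if n = 2 then 1 else 0) 3 (by norm_num) hM
  have h3 := h (fun n => if n = 3 then 1 else 0) 3 (by norm_num) hM
  have e : Finset.Icc 1 3 = ({1, 2, 3} : Finset ℕ) := by decide
  rw [e] at h1 h2 h3
  norm_num at h1 h2 h3
  have hu : uh = -1 := by rw [h3] at h2; linarith
  rw [hu] at h1
  rcases h1 with (h1 | h1) | h1
  · rw [h1] at h3; norm_num at h3
  · rw [h1] at h3; norm_num at h3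
  · norm_num at h1
end

section
/- Fix integers M ≥ 3 and m ≥ 1. Let w_h, u_h, w_y ∈ ℝ^m be the parameters of a single-layer linear vanilla RNN with m neurons, and set c_l = w_y^{(l)} w_h^{(l)}. Then the RNN computes the first-order derivative of every length-M time series (i.e. y_t = x_t − x_{t−1} for every x ∈ ℝ^M and every 2 ≤ t ≤ M) if and only if the power-sum conditions hold: Σ_{l=1}^m c_l = 1, Σ_{l=1}^m c_l u_h^{(l)} = −1, and Σ_{l=1}^m c_l (u_h^{(l)})^k = 0 for every k with 2 ≤ k ≤ M − 1. -/
/-- For `M ≥ 3` and `m ≥ 1`, a single-layer linear vanilla RNN with `m` neurons and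
parameters `wh, uh, wy : Fin m → ℝ` (output
`y t = ∑ l, wy l * wh l * ∑ s ∈ Icc 1 t, (uh l) ^ (t - s) * x s`) computes the
first-order derivative of every length-`M` time series if and only if, with
`c l = wy l * wh l`, the power-sum conditions hold:
`∑ l, c l = 1`, `∑ l, c l * uh l = -1`, and `∑ l, c l * (uh l) ^ k = 0` for all
`2 ≤ k ≤ M - 1`. -/
theorem rnn_derivative_iff_power_sums (M m : ℕ) (hM : 3 ≤ M) (hm : 1 ≤ m)
    (wh uh wy : Fin m → ℝ) :
    (∀ x : ℕ → ℝ, ∀ t : ℕ, 2 ≤ t → t ≤ M →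
      (∑ l : Fin m, wy l * wh l * ∑ s ∈ Finset.Icc 1 t, uh l ^ (t - s) * x s)
        = x t - x (t - 1)) ↔
    ((∑ l : Fin m, wy l * wh l) = 1 ∧
     (∑ l : Fin m, wy l * wh l * uh l) = -1 ∧
     ∀ k : ℕ, 2 ≤ k → k ≤ M - 1 → (∑ l : Fin m, wy l * wh l * uh l ^ k) = 0) := by
  have key : ∀ (x : ℕ → ℝ) (t : ℕ),
      (∑ l : Fin m, wy l * wh l * ∑ s ∈ Finset.Icc 1 t, uh l ^ (t - s) * x s)
        = ∑ s ∈ Finset.Icc 1 t, (∑ l : Fin m, wy l * wh l * uh l ^ (t - s)) * x s := by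
    intro x t
    simp only [Finset.mul_sum, Finset.sum_mul]
    rw [Finset.sum_comm]
    refine Finset.sum_congr rfl fun s _ => Finset.sum_congr rfl fun l _ => ?_
    ring
  simp only [key]
  constructor
  · intro h
    have hk : ∀ k : ℕ, k ≤ M - 1 → (∑ l : Fin m, wy l * wh l * uh l ^ k)
        = (if M = M - k then 1 else 0) - (if M - 1 = M - k then 1 else 0) := by
      intro k hk
      have h1 := h (fun s => if s = M - k then 1 else 0) M (by omega) le_rfl
      simp only [mul_ite, mul_one, mul_zero, Finset.sum_ite_eq'] at h1
      rw [if_pos (Finset.mem_Icc.2 ⟨by omega, by omega⟩)] at h1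
      rwa [show M - (M - k) = k by omega] at h1
    refine ⟨?_, ?_, ?_⟩
    · have := hk 0 (by omega)
      rw [if_pos (by omega), if_neg (by omega)] at this
      simpa using this
    · have := hk 1 (by omega)
      rw [if_neg (by omega), if_pos (by omega)] at this
      simpa using this
    · intro k h2 h3
      have := hk k h3
      rw [if_neg (by omega), if_neg (by omega)] at this
      simpa using this
  · rintro ⟨h0, h1, h2⟩ x t ht htM
    obtain ⟨n, rfl⟩ : ∃ n, t = n + 1 + 1 := ⟨t - 2, by omega⟩
    rw [Finset.sum_Icc_succ_top (by omega), Finset.sum_Icc_succ_top (by omega),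
      Finset.sum_eq_zero]
    · rw [show n + 1 + 1 - (n + 1) = 1 by omega, show n + 1 + 1 - (n + 1 + 1) = 0 by omega,
        show n + 1 + 1 - 1 = n + 1 by omega]
      simp only [pow_one, pow_zero, mul_one, h0, h1]
      ring
    · intro s hs
      rw [Finset.mem_Icc] at hs
      rw [h2 _ (by omega) (by omega), zero_mul]
end

section
/- Let M ≥ 3 and 1 ≤ m ≤ M − 2 be integers, let u_1, …, u_m be pairwise distinct real numbers, and let c_1, …, c_m be real numbers. If Σ_{l=1}^m c_l (1 + u_l) = 0 and Σ_{l=1}^m c_l u_l^k = 0 for every k with 2 ≤ k ≤ M − 1, then c_1 = c_2 = ⋯ = c_m = 0. -/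
/-- Key homogeneous-system lemma: for `M ≥ 3`, `1 ≤ m ≤ M - 2`, pairwise distinct
reals `u : Fin m → ℝ` and coefficients `c : Fin m → ℝ`, if
`∑ l, c l * (1 + u l) = 0` and `∑ l, c l * (u l) ^ k = 0` for all `2 ≤ k ≤ M - 1`,
then all `c l` vanish. -/
theorem homogeneous_vandermonde_only_trivial (M m : ℕ) (hM : 3 ≤ M)
    (hm1 : 1 ≤ m) (hm : m ≤ M - 2) (u c : Fin m → ℝ)
    (hdist : Function.Injective u)
    (h1 : (∑ l : Fin m, c l * (1 + u l)) = 0)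
    (h2 : ∀ k : ℕ, 2 ≤ k → k ≤ M - 1 → (∑ l : Fin m, c l * u l ^ k) = 0) :
    ∀ l : Fin m, c l = 0 := by
  have key : (fun l => c l * u l ^ 2) = 0 := by
    refine Matrix.eq_zero_of_forall_pow_sum_mul_pow_eq_zero hdist ?_
    intro i
    rw [← h2 (i + 2) (by omega) (by have := i.isLt; omega)]
    refine Finset.sum_congr rfl fun l _ => ?_
    ring
  have hz : ∀ l, u l ≠ 0 → c l = 0 := by
    intro l hl
    have h := congrFun key l
    simpa [hl] using h
  intro l
  by_cases hl : u l = 0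
  · rw [Finset.sum_eq_single l] at h1
    · simpa [hl] using h1
    · intro b _ hb
      rw [hz b (fun h => hb (hdist (h.trans hl.symm))), zero_mul]
    · simp
  · exact hz l hl
end
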